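/- Let k be a field and let q ∈ k be nonzero. Set A = GL_q(2) and Z = GL_q(2,-2), with the coaction α : Z → A ⊗ Z given by α(z_{ij}) = Σ_k x_{ik} ⊗ z_{kj} and α(τ) = t ⊗ τ. Then Z is an A-Galois extension of k: Z is nonzero and the k-linear map (id_A ⊗ m_Z) ∘ (α ⊗ id_Z) : Z ⊗ Z → A ⊗ Z (sending z ⊗ z' to α(z)·(1_A ⊗ z')) is bijective. -/

import Mathlib

open TensorProduct

/-- The five generators `x11, x12, x21, x22, t` of the algebra `GL_q(2)`. -/
inductive XGen : Type
  | x11 | x12 | x21 | x22 | t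

def Xf (k : Type) [Field k] : XGen → FreeAlgebra k XGen := FreeAlgebra.ι k

/-- The defining relations of `GL_q(2)`. -/
inductive GLq2Rel (k : Type) [Field k] (q : k) :
    FreeAlgebra k XGen → FreeAlgebra k XGen → Prop
  | r1 : GLq2Rel k q (Xf k .x12 * Xf k .x11) (q • (Xf k .x11 * Xf k .x12))
  | r2 : GLq2Rel k q (Xf k .x21 * Xf k .x11) (q • (Xf k .x11 * Xf k .x21))
  | r3 : GLq2Rel k q (Xf k .x22 * Xf k .x12) (q • (Xf k .x12 * Xf k .x22))
  | r4 : GLq2Rel k q (Xf k .x22 * Xf k .x21) (q • (Xf k .x21 * Xf k .x22))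
  | r5 : GLq2Rel k q (Xf k .x12 * Xf k .x21) (Xf k .x21 * Xf k .x12)
  | r6 : GLq2Rel k q (Xf k .x11 * Xf k .x22 - Xf k .x22 * Xf k .x11)
      ((q⁻¹ - q) • (Xf k .x12 * Xf k .x21))
  | r7 : GLq2Rel k q (Xf k .x11 * Xf k .t) (Xf k .t * Xf k .x11)
  | r8 : GLq2Rel k q (Xf k .x22 * Xf k .t) (Xf k .t * Xf k .x22)
  | r9 : GLq2Rel k q (Xf k .x12 * Xf k .t) (Xf k .t * Xf k .x12)
  | r10 : GLq2Rel k q (Xf k .x21 * Xf k .t) (Xf k .t * Xf k .x21)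
  | r11 : GLq2Rel k q ((Xf k .x11 * Xf k .x22 - q⁻¹ • (Xf k .x12 * Xf k .x21)) * Xf k .t) 1

/-- The algebra `GL_q(2)`. -/
abbrev GLq2 (k : Type) [Field k] (q : k) := RingQuot (GLq2Rel k q)

/-- The five generators `z11, z12, z21, z22, τ` of the algebra `GL_q(2,-2)`. -/
inductive ZGen : Type
  | z11 | z12 | z21 | z22 | tau

def Zf (k : Type) [Field k] : ZGen → FreeAlgebra k ZGen := FreeAlgebra.ι k

/-- The defining relations of `GL_q(2,-2)`. -/
inductive GLq22Rel (k : Type) [Field k] (q : k) :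
    FreeAlgebra k ZGen → FreeAlgebra k ZGen → Prop
  | r1 : GLq22Rel k q (Zf k .z12 * Zf k .z11) (-(q • (Zf k .z11 * Zf k .z12)))
  | r2 : GLq22Rel k q (Zf k .z21 * Zf k .z11) (q • (Zf k .z11 * Zf k .z21))
  | r3 : GLq22Rel k q (Zf k .z22 * Zf k .z12) (q • (Zf k .z12 * Zf k .z22))
  | r4 : GLq22Rel k q (Zf k .z22 * Zf k .z21) (-(q • (Zf k .z21 * Zf k .z22)))
  | r5 : GLq22Rel k q (Zf k .z12 * Zf k .z21) (-(Zf k .z21 * Zf k .z12))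
  | r6 : GLq22Rel k q (Zf k .z11 * Zf k .z22 + Zf k .z22 * Zf k .z11)
      ((q - q⁻¹) • (Zf k .z12 * Zf k .z21))
  | r7 : GLq22Rel k q (Zf k .z11 * Zf k .tau) (-(Zf k .tau * Zf k .z11))
  | r8 : GLq22Rel k q (Zf k .z22 * Zf k .tau) (-(Zf k .tau * Zf k .z22))
  | r9 : GLq22Rel k q (Zf k .z12 * Zf k .tau) (-(Zf k .tau * Zf k .z12))
  | r10 : GLq22Rel k q (Zf k .z21 * Zf k .tau) (-(Zf k .tau * Zf k .z21))
  | r11 : GLq22Rel k q ((Zf k .z11 * Zf k .z22 + q⁻¹ • (Zf k .z12 * Zf k .z21)) * Zf k .tau) 1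

/-- The algebra `GL_q(2,-2)`. -/
abbrev GLq22 (k : Type) [Field k] (q : k) := RingQuot (GLq22Rel k q)

noncomputable section

/-- The generating matrix entries `x_{ij}` of `GL_q(2)`. -/
def xM (k : Type) [Field k] (q : k) : Fin 2 → Fin 2 → GLq2 k q :=
  ![![RingQuot.mkAlgHom k (GLq2Rel k q) (Xf k .x11),
     RingQuot.mkAlgHom k (GLq2Rel k q) (Xf k .x12)],
    ![RingQuot.mkAlgHom k (GLq2Rel k q) (Xf k .x21),
     RingQuot.mkAlgHom k (GLq2Rel k q) (Xf k .x22)]]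

/-- The element `t` of `GL_q(2)`. -/
def tE (k : Type) [Field k] (q : k) : GLq2 k q := RingQuot.mkAlgHom k (GLq2Rel k q) (Xf k .t)

/-- The generating matrix entries `z_{ij}` of `GL_q(2,-2)`. -/
def zM (k : Type) [Field k] (q : k) : Fin 2 → Fin 2 → GLq22 k q :=
  ![![RingQuot.mkAlgHom k (GLq22Rel k q) (Zf k .z11),
     RingQuot.mkAlgHom k (GLq22Rel k q) (Zf k .z12)],
    ![RingQuot.mkAlgHom k (GLq22Rel k q) (Zf k .z21),
     RingQuot.mkAlgHom k (GLq22Rel k q) (Zf k .z22)]]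

/-- The element `τ` of `GL_q(2,-2)`. -/
def tauE (k : Type) [Field k] (q : k) : GLq22 k q :=
  RingQuot.mkAlgHom k (GLq22Rel k q) (Zf k .tau)

section QuantumMatrix

variable {k : Type*} [Field k] {R S : Type*} [Ring R] [Algebra k R] [Ring S] [Algebra k S]

/-- The relations of an invertible `2 × 2` quantum matrix `(a, b; c, d)` with inverse quantum
determinant `t`, where `s` and `u` are the signs twisting the column and the row relations:
`GL_q(2)` has `s = u = 1`, and `GL_q(2,-2)` has `s = 1`, `u = -1`. -/
structure IsQuantumMatrix (q s u : k) (a b c d t : R) : Prop where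
  ba : b * a = (u * q) • (a * b)
  ca : c * a = (s * q) • (a * c)
  db : d * b = (s * q) • (b * d)
  dc : d * c = (u * q) • (c * d)
  cb : c * b = (s * u) • (b * c)
  da : d * a = (s * u) • (a * d) - (s * (q⁻¹ - q)) • (b * c)
  ta : t * a = (s * u) • (a * t)
  tb : t * b = (s * u) • (b * t)
  tc : t * c = (s * u) • (c * t)
  td : t * d = (s * u) • (d * t)
  det_mul : (a * d - (u * q⁻¹) • (b * c)) * t = 1

namespace IsQuantumMatrix

theorem tmul {q s m u : k} (hq : q ≠ 0) (hm : m * m = 1) (hu : u * u = 1)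
    {a b c d t : R} {a' b' c' d' t' : S}
    (h : IsQuantumMatrix q s m a b c d t) (h' : IsQuantumMatrix q m u a' b' c' d' t') :
    IsQuantumMatrix q s u (a ⊗ₜ[k] a' + b ⊗ₜ[k] c') (a ⊗ₜ[k] b' + b ⊗ₜ[k] d')
      (c ⊗ₜ[k] a' + d ⊗ₜ[k] c') (c ⊗ₜ[k] b' + d ⊗ₜ[k] d') (t ⊗ₜ[k] t') := by
  have hdet : (a ⊗ₜ[k] a' + b ⊗ₜ[k] c') * (c ⊗ₜ[k] b' + d ⊗ₜ[k] d') -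
      (u * q⁻¹) • ((a ⊗ₜ[k] b' + b ⊗ₜ[k] d') * (c ⊗ₜ[k] a' + d ⊗ₜ[k] c')) =
      (a * d - (m * q⁻¹) • (b * c)) ⊗ₜ[k] (a' * d' - (u * q⁻¹) • (b' * c')) := by
    simp only [add_mul, mul_add, Algebra.TensorProduct.tmul_mul_tmul, h'.ba, h'.dc, h'.cb,
      h'.da, TensorProduct.tmul_smul, ← TensorProduct.smul_tmul', TensorProduct.tmul_sub,
      TensorProduct.sub_tmul, smul_sub]
    match_scalars <;> field_simp <;> grind
  constructor
  case det_mul =>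
    rw [hdet, Algebra.TensorProduct.tmul_mul_tmul, h.det_mul, h'.det_mul]; rfl
  all_goals
    simp only [add_mul, mul_add, Algebra.TensorProduct.tmul_mul_tmul, h.ba, h.ca, h.db, h.dc,
      h.cb, h.da, h'.ba, h'.ca, h'.db, h'.dc, h'.cb, h'.da, h.ta, h.tb, h.tc, h.td,
      h'.ta, h'.tb, h'.tc, h'.td, TensorProduct.tmul_smul,
      ← TensorProduct.smul_tmul', TensorProduct.tmul_sub, TensorProduct.sub_tmul, smul_sub]
    match_scalars <;> field_simp <;> grind

section Twisted

variable {q : k} {a b c d t : R}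

theorem of_twisted (ba : b * a = -(q • (a * b))) (ca : c * a = q • (a * c))
    (db : d * b = q • (b * d)) (dc : d * c = -(q • (c * d))) (cb : b * c = -(c * b))
    (da : a * d + d * a = (q - q⁻¹) • (b * c)) (ta : a * t = -(t * a)) (td : d * t = -(t * d))
    (tb : b * t = -(t * b)) (tc : c * t = -(t * c)) (det_mul : (a * d + q⁻¹ • (b * c)) * t = 1) :
    IsQuantumMatrix q 1 (-1) a b c d t := by
  constructor
  case det_mul => rwa [neg_mul, neg_smul, sub_neg_eq_add, one_mul]
  case da => rw [eq_sub_of_add_eq' da]; module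
  all_goals simp only [one_mul, neg_mul, neg_smul, one_smul, ba, ca, db, dc, cb, ta, tb, tc, td,
    neg_neg]

theorem det_mul' (h : IsQuantumMatrix q 1 (-1) a b c d t) :
    (a * d + q⁻¹ • (b * c)) * t = 1 := by
  simpa using h.det_mul

theorem mul_det (h : IsQuantumMatrix q 1 (-1) a b c d t) :
    t * (a * d + q⁻¹ • (b * c)) = 1 := by
  have h1 := h.det_mul'
  simp only [add_mul, smul_mul_assoc, mul_assoc] at h1
  have ta := h.ta
  have tb := h.tb
  have tc := h.tc
  have td := h.td
  simp only [mul_neg, mul_one, neg_smul, one_smul] at ta tb tc td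
  simp only [mul_add, mul_smul_comm, ← mul_assoc, ta, tb, neg_mul]
  simpa only [mul_assoc, tc, td, mul_neg, neg_neg] using h1

/-- The inverse of a quantum matrix with signs `(1, -1)` is, in the opposite algebra, a quantum
matrix with signs `(-1, 1)`. -/
theorem inverse_op (hq : q ≠ 0) (h : IsQuantumMatrix q 1 (-1) a b c d t) :
    IsQuantumMatrix q (-1) 1 (MulOpposite.op (d * t)) (MulOpposite.op (-(q • (b * t))))
      (MulOpposite.op (q⁻¹ • (c * t))) (MulOpposite.op (-(a * t)))
      (MulOpposite.op (a * d + q⁻¹ • (b * c))) := by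
  have assoc_rw {x y z : R} {r : k} (e : x * y = r • z) (w : R) : x * (y * w) = r • (z * w) := by
    rw [← mul_assoc, e, smul_mul_assoc]
  have da' (w : R) : d * (a * w) = ((1 : k) * -1) • (a * (d * w)) -
      ((1 : k) * (q⁻¹ - q)) • (b * (c * w)) := by
    rw [← mul_assoc, h.da]; simp only [sub_mul, smul_mul_assoc, mul_assoc]
  constructor
  case det_mul =>
    rw [← MulOpposite.op_one]
    simp only [← MulOpposite.op_mul, ← MulOpposite.op_sub, ← MulOpposite.op_smul]
    congr 1
    have key : -(a * t) * (d * t) - ((1 : k) * q⁻¹) • (q⁻¹ • (c * t) * -(q • (b * t))) =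
        (a * d - ((-1 : k) * q⁻¹) • (b * c)) * t * t := by
      simp only [sub_mul, neg_mul, mul_neg, smul_mul_assoc, mul_smul_comm, mul_assoc,
        assoc_rw h.td, assoc_rw h.tb, assoc_rw h.cb]
      match_scalars <;> field_simp
    rw [key, h.det_mul, one_mul]
    exact h.det_mul'
  all_goals
    apply MulOpposite.unop_injective
    simp only [MulOpposite.unop_mul, MulOpposite.unop_smul, MulOpposite.unop_sub,
      MulOpposite.unop_op, add_mul, mul_add, neg_mul, mul_neg, smul_mul_assoc,
      mul_smul_comm, mul_assoc, assoc_rw h.ta, assoc_rw h.tb, assoc_rw h.tc, assoc_rw h.td,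
      h.tc, h.td, assoc_rw h.ba, assoc_rw h.ca, assoc_rw h.db, assoc_rw h.dc,
      assoc_rw h.cb, da', smul_sub, smul_add, mul_sub]
    match_scalars <;> field_simp <;> grind

theorem sum_mul_inverse (hq : q ≠ 0) (h : IsQuantumMatrix q 1 (-1) a b c d t) (i j : Fin 2) :
    ∑ l : Fin 2, (![![a, b], ![c, d]] : Fin 2 → Fin 2 → R) i l *
      (![![d * t, -(q • (b * t))], ![q⁻¹ • (c * t), -(a * t)]] : Fin 2 → Fin 2 → R) l j =
      if i = j then 1 else 0 := by
  have h1 := h.det_mul'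
  simp only [add_mul, smul_mul_assoc] at h1
  fin_cases i <;> fin_cases j <;>
    simp only [Fin.zero_eta, Fin.mk_one, Fin.sum_univ_two, Matrix.cons_val_zero,
      Matrix.cons_val_one, mul_neg, mul_smul_comm, ← mul_assoc, h.ba, h.dc, h.cb, h.da,
      sub_mul, smul_mul_assoc, if_true, zero_ne_one, one_ne_zero, if_false]
  · exact h1
  · module
  · match_scalars; field_simp; ring
  · rw [← h1]; match_scalars <;> field_simp <;> ring

theorem sum_inverse_mul (hq : q ≠ 0) (h : IsQuantumMatrix q 1 (-1) a b c d t) (i j : Fin 2) :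
    ∑ l : Fin 2,
      (![![d * t, -(q • (b * t))], ![q⁻¹ • (c * t), -(a * t)]] : Fin 2 → Fin 2 → R) i l *
        (![![a, b], ![c, d]] : Fin 2 → Fin 2 → R) l j = if i = j then 1 else 0 := by
  have h1 := h.det_mul'
  simp only [add_mul, smul_mul_assoc] at h1
  fin_cases i <;> fin_cases j <;>
    simp only [Fin.zero_eta, Fin.mk_one, Fin.sum_univ_two, Matrix.cons_val_zero,
      Matrix.cons_val_one, neg_mul, smul_mul_assoc, mul_assoc, h.ta, h.tb, h.tc, h.td,
      mul_smul_comm]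
  all_goals
    simp only [← mul_assoc, h.cb, h.da, h.ca, h.db,
      sub_mul, smul_mul_assoc, if_true, zero_ne_one, one_ne_zero, if_false]
  · rw [← h1]; match_scalars <;> field_simp <;> ring
  · match_scalars; field_simp; ring
  · match_scalars; field_simp; ring
  · rw [← h1]; match_scalars <;> field_simp

end Twisted

end IsQuantumMatrix

end QuantumMatrix

section CanonicalMap

variable {k : Type*} [Field k] {A Z : Type*} [Ring A] [Algebra k A] [Ring Z] [Algebra k Z]

/-- The right `Z`-linear map `Y ⊗ Z → A ⊗ Z` extending a linear map `f : Y → A ⊗ Z`. -/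
abbrev canonicalMap {Y : Type*} [AddCommGroup Y] [Module k Y] (f : Y →ₗ[k] A ⊗[k] Z) :
    Y ⊗[k] Z →ₗ[k] A ⊗[k] Z :=
  (TensorProduct.map LinearMap.id (LinearMap.mul' k Z)) ∘ₗ
    (TensorProduct.assoc k A Z Z).toLinearMap ∘ₗ (TensorProduct.map f LinearMap.id)

theorem canonicalMap_tmul {Y : Type*} [AddCommGroup Y] [Module k Y] (f : Y →ₗ[k] A ⊗[k] Z)
    (y : Y) (z : Z) : canonicalMap f (y ⊗ₜ z) = f y * (1 ⊗ₜ z) := by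
  simp only [canonicalMap, LinearMap.comp_apply, TensorProduct.map_tmul, LinearMap.id_apply,
    LinearEquiv.coe_coe]
  induction f y using TensorProduct.induction_on with
  | zero => simp
  | tmul a w => simp
  | add x y hx hy => rw [TensorProduct.add_tmul, map_add, map_add, hx, hy, add_mul]

theorem canonicalMap_mul_one_tmul {Y : Type*} [Ring Y] [Algebra k Y] (f : Y →ₗ[k] A ⊗[k] Z)
    (η : Y ⊗[k] Z) (z : Z) :
    canonicalMap f (η * (1 ⊗ₜ z)) = canonicalMap f η * (1 ⊗ₜ z) := by
  induction η using TensorProduct.induction_on with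
  | zero => simp
  | tmul y w =>
    rw [Algebra.TensorProduct.tmul_mul_tmul, canonicalMap_tmul, canonicalMap_tmul, mul_assoc,
      Algebra.TensorProduct.tmul_mul_tmul, mul_one, mul_one]
  | add x y hx hy => simp only [add_mul, map_add, hx, hy]

variable (k Z) in
/-- The linear identification of `Z ⊗ Zᵐᵒᵖ` with `Z ⊗ Z`. -/
def tensorUnop : Z ⊗[k] Zᵐᵒᵖ ≃ₗ[k] Z ⊗[k] Z :=
  TensorProduct.congr (LinearEquiv.refl k Z) (MulOpposite.opLinearEquiv k).symm

@[simp]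
theorem tensorUnop_tmul (a : Z) (b : Zᵐᵒᵖ) : tensorUnop k Z (a ⊗ₜ b) = a ⊗ₜ b.unop := rfl

@[simp]
theorem tensorUnop_symm_tmul (a b : Z) :
    (tensorUnop k Z).symm (a ⊗ₜ b) = a ⊗ₜ MulOpposite.op b := rfl

theorem tensorUnop_mul_one_tmul (ξ ξ' : Z ⊗[k] Zᵐᵒᵖ) (w : Z) :
    tensorUnop k Z (ξ * ξ') * (1 ⊗ₜ w) =
      tensorUnop k Z ((tensorUnop k Z).symm (tensorUnop k Z ξ * (1 ⊗ₜ w)) * ξ') := by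
  induction ξ using TensorProduct.induction_on with
  | zero => simp
  | add x y hx hy => simp only [add_mul, map_add, hx, hy]
  | tmul a b =>
    induction ξ' using TensorProduct.induction_on with
    | zero => simp
    | add x y hx hy => simp only [add_mul, mul_add, map_add, hx, hy]
    | tmul c e => simp [mul_assoc]

theorem tensorUnop_tmul_one_mul (z : Z) (ξ : Z ⊗[k] Zᵐᵒᵖ) :
    tensorUnop k Z ((z ⊗ₜ 1) * ξ) = (z ⊗ₜ 1) * tensorUnop k Z ξ := by
  induction ξ using TensorProduct.induction_on with
  | zero => simp
  | add x y hx hy => simp only [mul_add, map_add, hx, hy]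
  | tmul c e => simp

variable (α : Z →ₐ[k] A ⊗[k] Z) (κ : A →ₐ[k] Z ⊗[k] Zᵐᵒᵖ)

/-- The map `A → Z ⊗ Z` underlying an algebra homomorphism `A → Z ⊗ Zᵐᵒᵖ`. -/
def translationMap : A →ₗ[k] Z ⊗[k] Z := (tensorUnop k Z).toLinearMap ∘ₗ κ.toLinearMap

theorem translationMap_apply (x : A) : translationMap κ x = tensorUnop k Z (κ x) := rfl

theorem canonicalMap_translationMap_mul {ζ : A ⊗[k] Z} {z : Z}
    (hζ : canonicalMap (translationMap κ) ζ = z ⊗ₜ 1) (η : A ⊗[k] Z) :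
    canonicalMap (translationMap κ) (ζ * η) =
      (z ⊗ₜ 1) * canonicalMap (translationMap κ) η := by
  induction η using TensorProduct.induction_on with
  | zero => simp
  | add x y hx hy => simp only [mul_add, map_add, hx, hy]
  | tmul x w =>
    have key (ζ : A ⊗[k] Z) : canonicalMap (translationMap κ) (ζ * (x ⊗ₜ w)) =
        tensorUnop k Z ((tensorUnop k Z).symm (canonicalMap (translationMap κ) ζ) * κ x) *
          (1 ⊗ₜ w) := by
      induction ζ using TensorProduct.induction_on with
      | zero => simp
      | add x y hx hy => simp only [add_mul, map_add, hx, hy]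
      | tmul y v =>
        rw [Algebra.TensorProduct.tmul_mul_tmul, canonicalMap_tmul, canonicalMap_tmul,
          translationMap_apply, translationMap_apply, ← tensorUnop_mul_one_tmul, map_mul,
          mul_assoc, Algebra.TensorProduct.tmul_mul_tmul, mul_one]
    rw [key, hζ, tensorUnop_symm_tmul, MulOpposite.op_one, tensorUnop_tmul_one_mul,
      canonicalMap_tmul, translationMap_apply, mul_assoc]

theorem canonicalMap_tensorUnop_mul {ξ' : Z ⊗[k] Zᵐᵒᵖ} {x : A}
    (hx : canonicalMap α.toLinearMap (tensorUnop k Z ξ') = x ⊗ₜ 1) (ξ : Z ⊗[k] Zᵐᵒᵖ) :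
    canonicalMap α.toLinearMap (tensorUnop k Z (ξ * ξ')) =
      canonicalMap α.toLinearMap (tensorUnop k Z ξ) * (x ⊗ₜ 1) := by
  induction ξ using TensorProduct.induction_on with
  | zero => simp
  | add x y hx hy => simp only [add_mul, map_add, hx, hy]
  | tmul a b =>
    have key : canonicalMap α.toLinearMap (tensorUnop k Z ((a ⊗ₜ b) * ξ')) =
        α a * canonicalMap α.toLinearMap (tensorUnop k Z ξ') * (1 ⊗ₜ b.unop) := by
      clear hx
      induction ξ' using TensorProduct.induction_on with
      | zero => simp
      | add x y hx hy => simp only [add_mul, mul_add, map_add, hx, hy]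
      | tmul c e =>
        rw [Algebra.TensorProduct.tmul_mul_tmul, tensorUnop_tmul, tensorUnop_tmul,
          canonicalMap_tmul, canonicalMap_tmul, AlgHom.toLinearMap_apply,
          AlgHom.toLinearMap_apply, map_mul]
        simp only [mul_assoc, Algebra.TensorProduct.tmul_mul_tmul, mul_one, MulOpposite.unop_mul]
    rw [key, hx, tensorUnop_tmul, canonicalMap_tmul, AlgHom.toLinearMap_apply, mul_assoc,
      mul_assoc, Algebra.TensorProduct.tmul_mul_tmul, Algebra.TensorProduct.tmul_mul_tmul]
    simp only [mul_one, one_mul]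

/-- A comodule algebra is Galois as soon as its coaction admits a translation map, which may be
checked on algebra generators. -/
theorem canonicalMap_bijective {s : Set Z} {r : Set A}
    (hs : Algebra.adjoin k s = ⊤) (hr : Algebra.adjoin k r = ⊤)
    (hα : ∀ z ∈ s, canonicalMap (translationMap κ) (α z) = z ⊗ₜ 1)
    (hκ : ∀ x ∈ r, canonicalMap α.toLinearMap (translationMap κ x) = x ⊗ₜ 1) :
    Function.Bijective (canonicalMap α.toLinearMap) := by
  have hα' (z : Z) : canonicalMap (translationMap κ) (α z) = z ⊗ₜ 1 := by
    have hz : z ∈ Algebra.adjoin k s := hs ▸ Algebra.mem_top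
    induction hz using Algebra.adjoin_induction with
    | mem z hz => exact hα z hz
    | algebraMap c =>
      simp only [Algebra.algebraMap_eq_smul_one, map_smul, map_one,
        Algebra.TensorProduct.one_def, canonicalMap_tmul, translationMap_apply,
        tensorUnop_tmul, MulOpposite.unop_one, ← TensorProduct.smul_tmul']
      simp
    | add x y _ _ hx hy => rw [map_add, map_add, hx, hy, TensorProduct.add_tmul]
    | mul x y _ _ hx hy =>
      rw [map_mul, canonicalMap_translationMap_mul κ hx, hy,
        Algebra.TensorProduct.tmul_mul_tmul, mul_one]
  have hκ' (x : A) : canonicalMap α.toLinearMap (translationMap κ x) = x ⊗ₜ 1 := by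
    have hx : x ∈ Algebra.adjoin k r := hr ▸ Algebra.mem_top
    induction hx using Algebra.adjoin_induction with
    | mem x hx => exact hκ x hx
    | algebraMap c =>
      simp only [Algebra.algebraMap_eq_smul_one, map_smul, map_one,
        Algebra.TensorProduct.one_def, canonicalMap_tmul, translationMap_apply,
        tensorUnop_tmul, MulOpposite.unop_one, ← TensorProduct.smul_tmul',
        AlgHom.toLinearMap_apply]
      simp
    | add x y _ _ hx hy => rw [map_add, map_add, hx, hy, TensorProduct.add_tmul]
    | mul x y _ _ hx hy =>
      rw [translationMap_apply, map_mul, canonicalMap_tensorUnop_mul α (ξ' := κ y) hy,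
        ← translationMap_apply, hx, Algebra.TensorProduct.tmul_mul_tmul, mul_one]
  refine Function.bijective_iff_has_inverse.mpr
    ⟨canonicalMap (translationMap κ), fun ζ ↦ ?_, fun η ↦ ?_⟩
  · induction ζ using TensorProduct.induction_on with
    | zero => simp only [map_zero]
    | add x y hx hy => rw [map_add, map_add, hx, hy]
    | tmul z w =>
      rw [canonicalMap_tmul, canonicalMap_mul_one_tmul, AlgHom.toLinearMap_apply, hα',
        Algebra.TensorProduct.tmul_mul_tmul, mul_one, one_mul]
  · induction η using TensorProduct.induction_on with
    | zero => simp only [map_zero]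
    | add x y hx hy => rw [map_add, map_add, hx, hy]
    | tmul x w =>
      rw [canonicalMap_tmul, canonicalMap_mul_one_tmul, hκ',
        Algebra.TensorProduct.tmul_mul_tmul, mul_one, one_mul]

end CanonicalMap

section Generators

variable (k : Type) [Field k] (q : k)

theorem isQuantumMatrix_xM : IsQuantumMatrix q (1 : k) 1 (xM k q 0 0) (xM k q 0 1) (xM k q 1 0)
    (xM k q 1 1) (tE k q) := by
  have rel {x y : FreeAlgebra k XGen} (h : GLq2Rel k q x y) := RingQuot.mkAlgHom_rel k h
  have h6 := rel .r6
  have h11 := rel .r11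
  simp only [map_sub, map_mul, map_smul, map_one] at h6 h11
  constructor <;> simp only [xM, tE, Matrix.cons_val_zero, Matrix.cons_val_one, one_mul,
    one_smul, ← map_mul]
  case ba => simpa using rel .r1
  case ca => simpa using rel .r2
  case db => simpa using rel .r3
  case dc => simpa using rel .r4
  case cb => exact (rel .r5).symm
  case da => rw [map_mul, map_mul, map_mul, ← h6, sub_sub_cancel]
  case ta => exact (rel .r7).symm
  case tb => exact (rel .r9).symm
  case tc => exact (rel .r10).symm
  case td => exact (rel .r8).symm
  case det_mul => simpa using h11

theorem isQuantumMatrix_zM : IsQuantumMatrix q (1 : k) (-1) (zM k q 0 0) (zM k q 0 1)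
    (zM k q 1 0) (zM k q 1 1) (tauE k q) := by
  have rel {x y : FreeAlgebra k ZGen} (h : GLq22Rel k q x y) := RingQuot.mkAlgHom_rel k h
  apply IsQuantumMatrix.of_twisted <;> simp only [tauE, zM, Matrix.cons_val_zero,
    Matrix.cons_val_one]
  · simpa using rel .r1
  · simpa using rel .r2
  · simpa using rel .r3
  · simpa using rel .r4
  · simpa using rel .r5
  · simpa using rel .r6
  · simpa using rel .r7
  · simpa using rel .r8
  · simpa using rel .r9
  · simpa using rel .r10
  · simpa using rel .r11

variable {k q}

section Lift

variable {R : Type*} [Ring R] [Algebra k R] {a b c d t : R}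

/-- The algebra homomorphism out of `GL_q(2)` determined by a quantum matrix. -/
def GLq2.lift (h : IsQuantumMatrix q (1 : k) 1 a b c d t) : GLq2 k q →ₐ[k] R :=
  RingQuot.liftAlgHom k ⟨FreeAlgebra.lift k fun
    | .x11 => a | .x12 => b | .x21 => c | .x22 => d | .t => t, by
    intro x y hxy
    have h11 := h.det_mul
    rw [one_mul] at h11
    cases hxy <;> simp only [Xf, map_mul, map_smul, map_sub, map_one, FreeAlgebra.lift_ι_apply,
      h.ba, h.ca, h.db, h.dc, h.cb, h.da, h.ta, h.tb, h.tc, h.td, h11, one_mul, one_smul,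
      sub_sub_cancel]⟩

theorem GLq2.lift_xM (h : IsQuantumMatrix q (1 : k) 1 a b c d t) (i j : Fin 2) :
    GLq2.lift h (xM k q i j) = ![![a, b], ![c, d]] i j := by
  fin_cases i <;> fin_cases j <;>
    simp [GLq2.lift, xM, Xf, RingQuot.liftAlgHom_mkAlgHom_apply]

theorem GLq2.lift_tE (h : IsQuantumMatrix q (1 : k) 1 a b c d t) :
    GLq2.lift h (tE k q) = t := by
  simp [GLq2.lift, tE, Xf, RingQuot.liftAlgHom_mkAlgHom_apply]

/-- The algebra homomorphism out of `GL_q(2,-2)` determined by a twisted quantum matrix. -/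
def GLq22.lift (h : IsQuantumMatrix q (1 : k) (-1) a b c d t) : GLq22 k q →ₐ[k] R :=
  RingQuot.liftAlgHom k ⟨FreeAlgebra.lift k fun
    | .z11 => a | .z12 => b | .z21 => c | .z22 => d | .tau => t, by
    intro x y hxy
    have h11 := h.det_mul
    rw [neg_mul, neg_smul, sub_neg_eq_add, one_mul] at h11
    cases hxy <;> simp only [Zf, map_mul, map_smul, map_add, map_neg, map_one,
      FreeAlgebra.lift_ι_apply, h.ba, h.ca, h.db, h.dc, h.cb, h.da, h.ta, h.tb, h.tc, h.td, h11,
      one_mul] <;> module⟩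

theorem GLq22.lift_zM (h : IsQuantumMatrix q (1 : k) (-1) a b c d t) (i j : Fin 2) :
    GLq22.lift h (zM k q i j) = ![![a, b], ![c, d]] i j := by
  fin_cases i <;> fin_cases j <;>
    simp [GLq22.lift, zM, Zf, RingQuot.liftAlgHom_mkAlgHom_apply]

theorem GLq22.lift_tauE (h : IsQuantumMatrix q (1 : k) (-1) a b c d t) :
    GLq22.lift h (tauE k q) = t := by
  simp [GLq22.lift, tauE, Zf, RingQuot.liftAlgHom_mkAlgHom_apply]

end Lift

theorem GLq22.hom_ext {R : Type*} [Semiring R] [Algebra k R] {f g : GLq22 k q →ₐ[k] R}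
    (hz : ∀ i j, f (zM k q i j) = g (zM k q i j)) (ht : f (tauE k q) = g (tauE k q)) :
    f = g := by
  refine RingQuot.ringQuot_ext' _ _ _ (FreeAlgebra.hom_ext (funext fun x ↦ ?_))
  cases x
  · exact hz 0 0
  · exact hz 0 1
  · exact hz 1 0
  · exact hz 1 1
  · exact ht

variable (k q)

theorem GLq2.adjoin_eq_top :
    Algebra.adjoin k (insert (tE k q) (Set.range fun p : Fin 2 × Fin 2 ↦ xM k q p.1 p.2)) = ⊤ := by
  rw [eq_top_iff, ← (AlgHom.range_eq_top _).mpr (RingQuot.mkAlgHom_surjective k (GLq2Rel k q)),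
    ← Algebra.map_top, ← FreeAlgebra.adjoin_range_ι, AlgHom.map_adjoin]
  refine Algebra.adjoin_mono ?_
  rintro _ ⟨_, ⟨x, rfl⟩, rfl⟩
  cases x
  · exact .inr ⟨(0, 0), rfl⟩
  · exact .inr ⟨(0, 1), rfl⟩
  · exact .inr ⟨(1, 0), rfl⟩
  · exact .inr ⟨(1, 1), rfl⟩
  · exact .inl rfl

theorem GLq22.adjoin_eq_top :
    Algebra.adjoin k (insert (tauE k q) (Set.range fun p : Fin 2 × Fin 2 ↦ zM k q p.1 p.2)) =
      ⊤ := by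
  rw [eq_top_iff, ← (AlgHom.range_eq_top _).mpr (RingQuot.mkAlgHom_surjective k (GLq22Rel k q)),
    ← Algebra.map_top, ← FreeAlgebra.adjoin_range_ι, AlgHom.map_adjoin]
  refine Algebra.adjoin_mono ?_
  rintro _ ⟨_, ⟨x, rfl⟩, rfl⟩
  cases x
  · exact .inr ⟨(0, 0), rfl⟩
  · exact .inr ⟨(0, 1), rfl⟩
  · exact .inr ⟨(1, 0), rfl⟩
  · exact .inr ⟨(1, 1), rfl⟩
  · exact .inl rfl

/-- `GL_q(2,-2)` acts on `k²` through two anticommuting involutions. -/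
theorem GLq22.nontrivial : Nontrivial (GLq22 k q) := by
  have h : IsQuantumMatrix q (1 : k) (-1) (!![0, 1; 1, 0] : Matrix (Fin 2) (Fin 2) k) 0 0
      !![1, 0; 0, -1] !![0, 1; -1, 0] := by
    constructor <;> ext i j <;> fin_cases i <;> fin_cases j <;> simp
  exact (GLq22.lift h).toRingHom.domain_nontrivial

variable {k q}

/-- The comultiplication of `GL_q(2)`. -/
def GLq2.comul (hq : q ≠ 0) : GLq2 k q →ₐ[k] GLq2 k q ⊗[k] GLq2 k q :=
  GLq2.lift ((isQuantumMatrix_xM k q).tmul hq (by simp) (by simp) (isQuantumMatrix_xM k q))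

variable (k q) in
/-- The counit of `GL_q(2)`. -/
def GLq2.counit : GLq2 k q →ₐ[k] k :=
  GLq2.lift (a := 1) (b := 0) (c := 0) (d := 1) (t := 1) (by constructor <;> simp)

/-- The coaction of `GL_q(2)` on `GL_q(2,-2)`. -/
def GLq22.coaction (hq : q ≠ 0) : GLq22 k q →ₐ[k] GLq2 k q ⊗[k] GLq22 k q :=
  GLq22.lift ((isQuantumMatrix_xM k q).tmul hq (by simp) (by simp) (isQuantumMatrix_zM k q))

/-- The homomorphism `GL_q(2) → Z ⊗ Zᵐᵒᵖ`, for `Z = GL_q(2,-2)`, sending the generating matrix of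
`GL_q(2)` to the product of the generating matrix of `Z` and its inverse. -/
def GLq22.translation (hq : q ≠ 0) : GLq2 k q →ₐ[k] GLq22 k q ⊗[k] (GLq22 k q)ᵐᵒᵖ :=
  GLq2.lift ((isQuantumMatrix_zM k q).tmul hq (by simp) (by simp)
    ((isQuantumMatrix_zM k q).inverse_op hq))

theorem GLq2.comul_xM (hq : q ≠ 0) (i j : Fin 2) :
    GLq2.comul hq (xM k q i j) = ∑ l : Fin 2, xM k q i l ⊗ₜ[k] xM k q l j := by
  rw [GLq2.comul, GLq2.lift_xM]
  fin_cases i <;> fin_cases j <;> simp [Fin.sum_univ_two]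

theorem GLq22.coaction_zM (hq : q ≠ 0) (i j : Fin 2) :
    GLq22.coaction hq (zM k q i j) = ∑ l : Fin 2, xM k q i l ⊗ₜ[k] zM k q l j := by
  rw [GLq22.coaction, GLq22.lift_zM]
  fin_cases i <;> fin_cases j <;> simp [Fin.sum_univ_two]

/-- The inverse of the generating matrix of `GL_q(2,-2)`. -/
def zInv (k : Type) [Field k] (q : k) : Fin 2 → Fin 2 → GLq22 k q :=
  ![![zM k q 1 1 * tauE k q, -(q • (zM k q 0 1 * tauE k q))],
    ![q⁻¹ • (zM k q 1 0 * tauE k q), -(zM k q 0 0 * tauE k q)]]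

theorem GLq22.translation_xM (hq : q ≠ 0) (i j : Fin 2) :
    translationMap (GLq22.translation hq) (xM k q i j) =
      ∑ l : Fin 2, zM k q i l ⊗ₜ[k] zInv k q l j := by
  rw [translationMap_apply, GLq22.translation, GLq2.lift_xM]
  fin_cases i <;> fin_cases j <;> simp [Fin.sum_univ_two, zInv]

theorem sum_zM_mul_zInv (hq : q ≠ 0) (i j : Fin 2) :
    ∑ l : Fin 2, zM k q i l * zInv k q l j = if i = j then 1 else 0 :=
  (isQuantumMatrix_zM k q).sum_mul_inverse hq i j

theorem sum_zInv_mul_zM (hq : q ≠ 0) (i j : Fin 2) :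
    ∑ l : Fin 2, zInv k q i l * zM k q l j = if i = j then 1 else 0 :=
  (isQuantumMatrix_zM k q).sum_inverse_mul hq i j

theorem GLq22.canonicalMap_coaction_bijective (hq : q ≠ 0) :
    Function.Bijective (canonicalMap (GLq22.coaction hq).toLinearMap) := by
  have h := isQuantumMatrix_zM k q
  have h1 := h.mul_det
  have h2 := h.det_mul'
  refine canonicalMap_bijective _ (GLq22.translation hq) (GLq22.adjoin_eq_top k q)
    (GLq2.adjoin_eq_top k q) ?_ ?_
  · rintro _ (rfl | ⟨⟨i, j⟩, rfl⟩)
    · rw [GLq22.coaction, GLq22.lift_tauE, canonicalMap_tmul, translationMap_apply,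
        GLq22.translation, GLq2.lift_tE, tensorUnop_tmul, MulOpposite.unop_op,
        Algebra.TensorProduct.tmul_mul_tmul, h2, mul_one]
    · simp only [GLq22.coaction_zM, map_sum, canonicalMap_tmul, GLq22.translation_xM,
        Finset.sum_mul, Algebra.TensorProduct.tmul_mul_tmul, mul_one]
      rw [Finset.sum_comm]
      simp only [← TensorProduct.tmul_sum, sum_zInv_mul_zM hq]
      fin_cases j <;> simp
  · rintro _ (rfl | ⟨⟨i, j⟩, rfl⟩)
    · rw [translationMap_apply, GLq22.translation, GLq2.lift_tE, tensorUnop_tmul,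
        canonicalMap_tmul, AlgHom.toLinearMap_apply, GLq22.coaction, GLq22.lift_tauE,
        MulOpposite.unop_op, Algebra.TensorProduct.tmul_mul_tmul, h1, mul_one]
    · simp only [GLq22.coaction_zM, map_sum, canonicalMap_tmul, GLq22.translation_xM,
        AlgHom.toLinearMap_apply, Finset.sum_mul, Algebra.TensorProduct.tmul_mul_tmul, mul_one]
      rw [Finset.sum_comm]
      simp only [← TensorProduct.tmul_sum, sum_zM_mul_zInv hq]
      fin_cases j <;> simp

end Generators

/-- `Z = GL_q(2,-2)` is a `GL_q(2)`-Galois extension of `k`: with the coaction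
`α(z_{ij}) = Σ_l x_{il} ⊗ z_{lj}`, `α(τ) = t ⊗ τ` (which makes `Z` a left
`GL_q(2)`-comodule algebra), `Z` is nonzero and the `k`-linear map
`(id ⊗ m_Z) ∘ (α ⊗ id) : Z ⊗ Z → A ⊗ Z` is bijective. -/
theorem GLq22_is_Galois (k : Type) [Field k] (q : k) (hq : q ≠ 0) :
    ∃ (Δ : GLq2 k q →ₐ[k] GLq2 k q ⊗[k] GLq2 k q) (ε : GLq2 k q →ₐ[k] k)
      (α : GLq22 k q →ₐ[k] GLq2 k q ⊗[k] GLq22 k q),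
      (∀ i j : Fin 2, Δ (xM k q i j) = ∑ l : Fin 2, xM k q i l ⊗ₜ[k] xM k q l j) ∧
      Δ (tE k q) = tE k q ⊗ₜ[k] tE k q ∧
      (∀ i j : Fin 2, ε (xM k q i j) = if i = j then 1 else 0) ∧
      ε (tE k q) = 1 ∧
      (∀ i j : Fin 2, α (zM k q i j) = ∑ l : Fin 2, xM k q i l ⊗ₜ[k] zM k q l j) ∧
      α (tauE k q) = tE k q ⊗ₜ[k] tauE k q ∧
      (Algebra.TensorProduct.assoc k k k (GLq2 k q) (GLq2 k q) (GLq22 k q)).toAlgHom.comp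
          ((Algebra.TensorProduct.map Δ (AlgHom.id k (GLq22 k q))).comp α) =
        (Algebra.TensorProduct.map (AlgHom.id k (GLq2 k q)) α).comp α ∧
      (Algebra.TensorProduct.lid k (GLq22 k q)).toAlgHom.comp
          ((Algebra.TensorProduct.map ε (AlgHom.id k (GLq22 k q))).comp α) =
        AlgHom.id k (GLq22 k q) ∧
      Nontrivial (GLq22 k q) ∧
      Function.Bijective
        ((TensorProduct.map LinearMap.id (LinearMap.mul' k (GLq22 k q))) ∘ₗ
          (TensorProduct.assoc k (GLq2 k q) (GLq22 k q) (GLq22 k q)).toLinearMap ∘ₗ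
          (TensorProduct.map α.toLinearMap LinearMap.id)) := by
  refine ⟨GLq2.comul hq, GLq2.counit k q, GLq22.coaction hq, GLq2.comul_xM hq,
    GLq2.lift_tE _, fun i j ↦ ?_, GLq2.lift_tE _, GLq22.coaction_zM hq, GLq22.lift_tauE _,
    GLq22.hom_ext (fun i j ↦ ?_) ?_, GLq22.hom_ext (fun i j ↦ ?_) ?_, GLq22.nontrivial k q,
    GLq22.canonicalMap_coaction_bijective hq⟩
  · rw [GLq2.counit, GLq2.lift_xM]
    fin_cases i <;> fin_cases j <;> rfl
  · simp only [AlgHom.comp_apply, GLq22.coaction_zM, map_sum, Algebra.TensorProduct.map_tmul,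
      GLq2.comul_xM, AlgHom.id_apply, TensorProduct.sum_tmul, TensorProduct.tmul_sum]
    rw [Finset.sum_comm]
    rfl
  · simp only [AlgHom.comp_apply, GLq22.coaction, GLq22.lift_tauE,
      Algebra.TensorProduct.map_tmul, GLq2.comul, GLq2.lift_tE, AlgHom.id_apply]
    rfl
  · simp only [AlgHom.comp_apply, GLq22.coaction_zM, map_sum, Algebra.TensorProduct.map_tmul,
      GLq2.counit, GLq2.lift_xM, AlgHom.id_apply]
    fin_cases i <;> fin_cases j <;> simp [Fin.sum_univ_two]
  · simp [GLq22.coaction, GLq22.lift_tauE, GLq2.counit, GLq2.lift_tE]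

end
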